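/- Let T > 0 and let ρ, u : [0,1] × [0,T] → ℝ be smooth with ρ > 0, satisfying the continuity equation ρ_t + (ρ u)_x = 0 on (0,1) × (0,T), the boundary conditions u(0,t) = u(1,t) = 0 for all t, and the normalization ∫₀¹ ρ(x,0) dx = 1. Set Q(0) := ∫₀¹ ρ(x,0) ( (1/ρ)_x(x,0) )² dx and M := ∫₀ᵀ∫₀¹ u_{xx}(x,t)² dx dt. Then for all (x,t) ∈ [0,1] × [0,T], 1/ρ(x,t) ≤ 2 + ( Q(0) + 2M ) · exp( t + M ); in particular ρ is bounded below by a positive constant depending only on Q(0), M and T. -/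

import Mathlib

open Set intervalIntegral

noncomputable section

/-- Spatial partial derivative of a function of `(x, t)`. -/
def pdx (f : ℝ → ℝ → ℝ) (x t : ℝ) : ℝ := deriv (fun y => f y t) x

/-- Time partial derivative of a function of `(x, t)`. -/
def pdt (f : ℝ → ℝ → ℝ) (x t : ℝ) : ℝ := deriv (fun s => f x s) t

/-- The quantity `Q(t) = ∫₀¹ ρ ((1/ρ)_x)² dx`. -/
def Qfun (ρ : ℝ → ℝ → ℝ) (t : ℝ) : ℝ :=
  ∫ x in (0:ℝ)..1, ρ x t * (pdx (fun y s => 1 / ρ y s) x t) ^ 2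

def Sm (f : ℝ → ℝ → ℝ) : Prop := ContDiff ℝ (⊤ : ℕ∞) (fun p : ℝ × ℝ => f p.1 p.2)

lemma Sm.cont {f} (h : Sm f) : Continuous (fun p : ℝ × ℝ => f p.1 p.2) := ContDiff.continuous h

lemma Sm.fd {f} (h : Sm f) (x t : ℝ) :
    HasFDerivAt (fun p : ℝ × ℝ => f p.1 p.2) (fderiv ℝ (fun p : ℝ × ℝ => f p.1 p.2) (x,t)) (x,t) :=
  (ContDiff.differentiable h (by simp) _).hasFDerivAt

lemma Sm.hx' {f} (h : Sm f) (x t : ℝ) :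
    HasDerivAt (fun y => f y t) (fderiv ℝ (fun p : ℝ × ℝ => f p.1 p.2) (x,t) (1,0)) x :=
  (h.fd x t).comp_hasDerivAt (f := fun y : ℝ => (y, t)) x
    ((hasDerivAt_id x).prodMk (hasDerivAt_const x t))

lemma Sm.ht' {f} (h : Sm f) (x t : ℝ) :
    HasDerivAt (fun y => f x y) (fderiv ℝ (fun p : ℝ × ℝ => f p.1 p.2) (x,t) (0,1)) t :=
  (h.fd x t).comp_hasDerivAt (f := fun y : ℝ => (x, y)) t
    ((hasDerivAt_const t x).prodMk (hasDerivAt_id t))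

lemma Sm.pdx_eq {f} (h : Sm f) (x t : ℝ) :
    pdx f x t = fderiv ℝ (fun p : ℝ × ℝ => f p.1 p.2) (x,t) (1,0) := (h.hx' x t).deriv
lemma Sm.pdt_eq {f} (h : Sm f) (x t : ℝ) :
    pdt f x t = fderiv ℝ (fun p : ℝ × ℝ => f p.1 p.2) (x,t) (0,1) := (h.ht' x t).deriv

lemma Sm.hx {f} (h : Sm f) (x t : ℝ) : HasDerivAt (fun y => f y t) (pdx f x t) x := by
  rw [h.pdx_eq]; exact h.hx' x t
lemma Sm.ht {f} (h : Sm f) (x t : ℝ) : HasDerivAt (fun y => f x y) (pdt f x t) t := by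
  rw [h.pdt_eq]; exact h.ht' x t

lemma Sm.fdsm {f} (h : Sm f) : ContDiff ℝ (⊤ : ℕ∞) (fderiv ℝ (fun p : ℝ × ℝ => f p.1 p.2)) :=
  ContDiff.fderiv_right h (by simp)

lemma Sm.pdx {f} (h : Sm f) : Sm (pdx f) := by
  have : ContDiff ℝ (⊤ : ℕ∞) (fun p : ℝ × ℝ => fderiv ℝ (fun p : ℝ × ℝ => f p.1 p.2) p (1,0)) :=
    h.fdsm.clm_apply contDiff_const
  unfold Sm
  convert this using 2 with p
  exact h.pdx_eq _ _
lemma Sm.pdt {f} (h : Sm f) : Sm (pdt f) := by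
  have : ContDiff ℝ (⊤ : ℕ∞) (fun p : ℝ × ℝ => fderiv ℝ (fun p : ℝ × ℝ => f p.1 p.2) p (0,1)) :=
    h.fdsm.clm_apply contDiff_const
  unfold Sm
  convert this using 2 with p
  exact h.pdt_eq _ _

lemma Sm.comm {f} (h : Sm f) (x t : ℝ) : _root_.pdt (_root_.pdx f) x t = _root_.pdx (_root_.pdt f) x t := by
  rw [h.pdx.pdt_eq, h.pdt.pdx_eq]
  have e1 : (fun p : ℝ × ℝ => _root_.pdx f p.1 p.2) =
    fun p => fderiv ℝ (fun p : ℝ × ℝ => f p.1 p.2) p (1,0) := by ext p; exact h.pdx_eq _ _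
  have e2 : (fun p : ℝ × ℝ => _root_.pdt f p.1 p.2) =
    fun p => fderiv ℝ (fun p : ℝ × ℝ => f p.1 p.2) p (0,1) := by ext p; exact h.pdt_eq _ _
  have hd : DifferentiableAt ℝ (fderiv ℝ (fun p : ℝ × ℝ => f p.1 p.2)) (x,t) :=
    h.fdsm.differentiable (by simp) _
  rw [e1, e2, fderiv_clm_apply hd (by fun_prop), fderiv_clm_apply hd (by fun_prop)]
  have hs : IsSymmSndFDerivAt ℝ (fun p : ℝ × ℝ => f p.1 p.2) (x,t) :=
    ContDiffAt.isSymmSndFDerivAt (n := (⊤ : ℕ∞)) (ContDiff.contDiffAt h) (by simp only [minSmoothness_of_isRCLikeNormedField]; exact WithTop.coe_le_coe.2 (le_top : (2:ℕ∞) ≤ ⊤))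
  simpa using hs.eq (0,1) (1,0)

lemma ext_cont {T : ℝ} (hT : 0 < T) {f : ℝ → ℝ → ℝ}
    (hf : ContinuousOn (fun p : ℝ × ℝ => f p.1 p.2) (Icc (0:ℝ) 1 ×ˢ Icc (0:ℝ) T)) :
    ∃ g : ℝ → ℝ → ℝ, Continuous (fun p : ℝ × ℝ => g p.1 p.2) ∧
      ∀ x ∈ Icc (0:ℝ) 1, ∀ t ∈ Icc (0:ℝ) T, g x t = f x t := by
  refine ⟨fun x t => f (max 0 (min 1 x)) (max 0 (min T t)), ?_, ?_⟩
  · refine hf.comp_continuous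
      (f := fun p : ℝ × ℝ => (max 0 (min 1 p.1), max 0 (min T p.2))) (by fun_prop) ?_
    intro p
    refine ⟨⟨le_max_left _ _, max_le zero_le_one (min_le_left _ _)⟩,
      ⟨le_max_left _ _, max_le hT.le (min_le_left _ _)⟩⟩
  · intro x hx t ht
    simp only
    rw [min_eq_right hx.2, max_eq_right hx.1, min_eq_right ht.2, max_eq_right ht.1]

lemma leib {T : ℝ} (hT : 0 < T) {F Ft : ℝ → ℝ → ℝ}
    (hF : ContinuousOn (fun p : ℝ × ℝ => F p.1 p.2) (Icc (0:ℝ) 1 ×ˢ Icc (0:ℝ) T))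
    (hFt : ContinuousOn (fun p : ℝ × ℝ => Ft p.1 p.2) (Icc (0:ℝ) 1 ×ˢ Icc (0:ℝ) T))
    (hd : ∀ x ∈ Icc (0:ℝ) 1, ∀ t ∈ Icc (0:ℝ) T, HasDerivAt (fun s => F x s) (Ft x t) t) :
    ∃ G : ℝ → ℝ, Continuous G ∧ (∀ s ∈ Icc (0:ℝ) T, G s = ∫ x in (0:ℝ)..1, Ft x s) ∧
      ∀ t ∈ Icc (0:ℝ) T, (∫ x in (0:ℝ)..1, F x t) = (∫ x in (0:ℝ)..1, F x 0) + ∫ s in (0:ℝ)..t, G s := by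
  obtain ⟨g, hg, hge⟩ := ext_cont hT hFt
  have hgc : Continuous fun s => ∫ x in (0:ℝ)..1, g x s := by
    apply intervalIntegral.continuous_parametric_intervalIntegral_of_continuous'
      (f := fun s x => g x s)
    exact hg.comp (continuous_snd.prodMk continuous_fst)
  refine ⟨fun s => ∫ x in (0:ℝ)..1, g x s, hgc, ?_, ?_⟩
  · intro s hs
    apply integral_congr
    intro x hx
    rw [uIcc_of_le zero_le_one] at hx
    exact hge x hx s hs
  · intro t ht
    have hI : ∀ s ∈ Icc (0:ℝ) T, IntervalIntegrable (fun x => F x s) MeasureTheory.volume 0 1 := by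
      intro s hs
      apply ContinuousOn.intervalIntegrable
      rw [uIcc_of_le zero_le_one]
      exact hF.comp (f := fun x : ℝ => (x, s)) (by fun_prop) (fun x hx => ⟨hx, hs⟩)
    have h0 : (0:ℝ) ∈ Icc 0 T := ⟨le_rfl, hT.le⟩
    rw [← sub_eq_iff_eq_add', ← intervalIntegral.integral_sub (hI t ht) (hI 0 h0)]
    rw [MeasureTheory.intervalIntegral_intervalIntegral_swap]
    · apply integral_congr
      intro x hx
      rw [uIcc_of_le zero_le_one] at hx
      simp only
      symm
      refine integral_eq_sub_of_hasDerivAt (f := fun s => F x s) ?_ ?_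
      · intro s hs
        rw [uIcc_of_le ht.1] at hs
        have hs' : s ∈ Icc 0 T := ⟨hs.1, hs.2.trans ht.2⟩
        rw [hge x hx s hs']
        exact hd x hx s hs'
      · exact (hg.comp (f := fun s : ℝ => (x, s)) (by fun_prop)).intervalIntegrable _ _
    · have hc : Continuous (Function.uncurry fun s x => g x s) :=
        hg.comp (continuous_snd.prodMk continuous_fst)
      exact (hc.continuousOn.integrableOn_compact (isCompact_uIcc.prod isCompact_uIcc)).mono_set
        (prod_mono uIoc_subset_uIcc uIoc_subset_uIcc)

lemma static {r v w : ℝ → ℝ} (hr : ContinuousOn r (Icc 0 1)) (hw : ContinuousOn w (Icc 0 1))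
    (hpos : ∀ x ∈ Icc (0:ℝ) 1, 0 < r x) (hrv : ∀ x ∈ Icc (0:ℝ) 1, r x * v x = 1)
    (hv : ∀ x ∈ Icc (0:ℝ) 1, HasDerivAt v (w x) x)
    (hm : ∫ x in (0:ℝ)..1, r x = 1) :
    ∀ x ∈ Icc (0:ℝ) 1, v x ≤ 2 + ∫ x in (0:ℝ)..1, r x * (w x)^2 := by
  have hvc : ContinuousOn v (Icc 0 1) := fun x hx => (hv x hx).continuousAt.continuousWithinAt
  have u01 : uIcc (0:ℝ) 1 = Icc 0 1 := uIcc_of_le zero_le_one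
  have hvpos : ∀ x ∈ Icc (0:ℝ) 1, 0 < v x := by
    intro x hx
    have := hrv x hx
    have h2 := hpos x hx
    by_contra hcon
    nlinarith [mul_nonneg h2.le (not_lt.1 hcon |> neg_nonneg.2)]
  obtain ⟨x0, hx0, hr0⟩ : ∃ x ∈ Icc (0:ℝ) 1, 1 ≤ r x := by
    obtain ⟨y, hy, hmax⟩ := isCompact_Icc.exists_isMaxOn (nonempty_Icc.2 zero_le_one) hr
    refine ⟨y, hy, ?_⟩
    have := integral_mono_on (μ := MeasureTheory.volume) (f := r) (g := fun _ => r y) zero_le_one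
      (ContinuousOn.intervalIntegrable (u01 ▸ hr)) (by simp) (fun x hx => hmax hx)
    simpa [hm] using this
  obtain ⟨y, hy, hmax⟩ := isCompact_Icc.exists_isMaxOn (nonempty_Icc.2 zero_le_one) hvc
  have hv0 : v x0 ≤ 1 := by
    have := hrv x0 hx0
    nlinarith [hvpos x0 hx0]
  have hsub : uIcc x0 y ⊆ Icc 0 1 := by
    rw [← u01]; exact uIcc_subset_uIcc (u01 ▸ hx0) (u01 ▸ hy)
  have e1 : ∫ x in x0..y, w x = v y - v x0 :=
    integral_eq_sub_of_hasDerivAt (fun x hx => hv x (hsub hx))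
      (ContinuousOn.intervalIntegrable (hw.mono hsub))
  have hwi : IntervalIntegrable (fun x => |w x|) MeasureTheory.volume 0 1 :=
    ContinuousOn.intervalIntegrable (u01 ▸ hw.abs)
  have hqi : IntervalIntegrable (fun x => r x * (w x)^2) MeasureTheory.volume 0 1 :=
    ContinuousOn.intervalIntegrable (u01 ▸ hr.mul (hw.pow 2))
  have e2 : ∫ x in x0..y, w x ≤ ∫ x in (0:ℝ)..1, |w x| := by
    calc ∫ x in x0..y, w x ≤ |∫ x in x0..y, w x| := le_abs_self _
      _ ≤ |(∫ x in x0..y, |w x|)| := norm_integral_le_abs_integral_norm (f := w)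
      _ ≤ |(∫ x in (0:ℝ)..1, |w x|)| :=
        abs_integral_mono_interval (by rw [uIoc_of_le (zero_le_one (α := ℝ))]; exact 
          fun z hz => ⟨lt_of_le_of_lt (le_min hx0.1 hy.1) hz.1, hz.2.trans (max_le hx0.2 hy.2)⟩)
          (Filter.Eventually.of_forall fun x => abs_nonneg _) hwi
      _ = _ := abs_of_nonneg (integral_nonneg zero_le_one fun x _ => abs_nonneg _)
  have e3 : ∫ x in (0:ℝ)..1, |w x| ≤ ∫ x in (0:ℝ)..1, (1/2 * (r x * (w x)^2) + v y / 2) := by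
    apply integral_mono_on zero_le_one hwi ((hqi.const_mul _).add (by simp))
    intro x hx
    have h1 := hrv x hx
    have h2 := hpos x hx
    have h3 := hvpos x hx
    have h4 : v x ≤ v y := hmax hx
    have : 2 * |w x| ≤ r x * (w x)^2 + v x := by
      have : 0 ≤ v x * (r x * |w x| - 1)^2 := by positivity
      have e : v x * (r x * |w x| - 1)^2 = (r x * v x) * (r x * |w x|^2) - 2 * (r x * v x) * |w x| + v x := by ring
      rw [e, h1, sq_abs] at this
      linarith
    linarith
  rw [intervalIntegral.integral_add (hqi.const_mul _) (by simp), intervalIntegral.integral_const_mul] at e3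
  simp at e3
  intro x hx
  have h4 : v x ≤ v y := hmax hx
  linarith

lemma gron {T : ℝ} (hT : 0 < T) {Q G m : ℝ → ℝ} (hG : Continuous G) (hm : Continuous m)
    (hm0 : ∀ t, 0 ≤ m t) (hQ0 : 0 ≤ Q 0)
    (hQ : ∀ t ∈ Icc 0 T, Q t = Q 0 + ∫ s in (0:ℝ)..t, G s)
    (hle : ∀ t ∈ Icc 0 T, G t ≤ Q t + (2 + Q t) * m t) :
    ∀ t ∈ Icc 0 T, Q t ≤ (Q 0 + 2 * ∫ s in (0:ℝ)..T, m s) * Real.exp (t + ∫ s in (0:ℝ)..T, m s) := by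
  set P : ℝ → ℝ := fun t => Q 0 + ∫ s in (0:ℝ)..t, G s with hP
  set N : ℝ → ℝ := fun t => ∫ s in (0:ℝ)..t, m s with hN
  have dP : ∀ t, HasDerivAt P (G t) t := fun t =>
    (integral_hasDerivAt_right (hG.intervalIntegrable _ _) hG.aestronglyMeasurable.stronglyMeasurableAtFilter hG.continuousAt).const_add _
  have dN : ∀ t, HasDerivAt N (m t) t := fun t =>
    (integral_hasDerivAt_right (hm.intervalIntegrable _ _) hm.aestronglyMeasurable.stronglyMeasurableAtFilter hm.continuousAt)
  have N0 : ∀ t, 0 ≤ t → 0 ≤ N t := fun t ht => integral_nonneg ht fun x _ => hm0 x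
  have dE : ∀ t, HasDerivAt (fun t => Real.exp (-(t + N t)) * P t - 2 * N t)
      (Real.exp (-(t + N t)) * (-(1 + m t)) * P t + Real.exp (-(t + N t)) * G t - 2 * m t) t := by
    intro t
    exact ((((hasDerivAt_id t).add (dN t)).neg.exp).mul (dP t)).sub ((dN t).const_mul 2)
  have anti : AntitoneOn (fun t => Real.exp (-(t + N t)) * P t - 2 * N t) (Icc 0 T) := by
    apply antitoneOn_of_deriv_nonpos (convex_Icc _ _)
    · exact fun t _ => (dE t).continuousAt.continuousWithinAt
    · exact fun t _ => (dE t).differentiableAt.differentiableWithinAt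
    · intro t ht
      rw [interior_Icc] at ht
      rw [(dE t).deriv]
      have h1 := hle t (Ioo_subset_Icc_self ht)
      rw [hQ t (Ioo_subset_Icc_self ht)] at h1
      change G t ≤ P t + (2 + P t) * m t at h1
      have h2 : Real.exp (-(t + N t)) ≤ 1 := Real.exp_le_one_iff.2 (by linarith [N0 t ht.1.le, ht.1])
      have h3 := Real.exp_pos (-(t + N t))
      nlinarith [mul_le_mul_of_nonneg_left h1 h3.le, mul_le_mul_of_nonneg_right h2 (hm0 t)]
  intro t ht
  have h := anti ⟨le_rfl, hT.le⟩ ht ht.1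
  have hP0 : P 0 = Q 0 := by simp [hP]
  have hN0 : N 0 = 0 := by simp [hN]
  simp only [hP0, hN0] at h
  simp at h
  have hNm : N t ≤ N T := by
    have : MonotoneOn N (Icc 0 T) := by
      apply monotoneOn_of_deriv_nonneg (convex_Icc _ _)
      · exact fun t _ => (dN t).continuousAt.continuousWithinAt
      · exact fun t _ => (dN t).differentiableAt.differentiableWithinAt
      · intro t _; rw [(dN t).deriv]; exact hm0 t
    exact this ht ⟨hT.le, le_rfl⟩ ht.2
  rw [hQ t ht]
  change P t ≤ (Q 0 + 2 * N T) * Real.exp (t + N T)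
  have k1 : P t = Real.exp (t + N t) * (Real.exp (-(t + N t)) * P t) := by
    rw [← mul_assoc, ← Real.exp_add]; simp
  have k2 : Real.exp (-(t + N t)) * P t ≤ Q 0 + 2 * N t := by
    rw [neg_add, add_comm (-t)]; linarith
  have k3 := N0 t ht.1
  rw [k1, mul_comm]
  calc _ ≤ (Q 0 + 2 * N t) * Real.exp (t + N t) := mul_le_mul_of_nonneg_right k2 (Real.exp_pos _).le
    _ ≤ _ := by
      have : 0 ≤ Q 0 + 2 * N T := by linarith
      gcongr

lemma zero_ext {T : ℝ} (hT : 0 < T) {f : ℝ → ℝ → ℝ} (hf : Continuous (fun p : ℝ × ℝ => f p.1 p.2))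
    (h0 : ∀ x ∈ Ioo (0:ℝ) 1, ∀ t ∈ Ioo (0:ℝ) T, f x t = 0) :
    ∀ x ∈ Icc (0:ℝ) 1, ∀ t ∈ Icc (0:ℝ) T, f x t = 0 := by
  intro x hx t ht
  have h : EqOn (fun p : ℝ × ℝ => f p.1 p.2) (fun _ => 0) (Ioo (0:ℝ) 1 ×ˢ Ioo (0:ℝ) T) :=
    fun p hp => h0 p.1 hp.1 p.2 hp.2
  have h2 := h.closure hf continuous_const
  rw [closure_prod_eq, closure_Ioo zero_ne_one, closure_Ioo hT.ne] at h2
  exact h2 (show (x, t) ∈ _ from ⟨hx, ht⟩)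

/-- For a smooth positive density `ρ` and velocity `u` satisfying
the continuity equation on `(0,1) × (0,T)`, vanishing of `u` at the endpoints and
`∫₀¹ ρ(·,0) = 1`, one has the uniform lower bound on the density:
`1/ρ(x,t) ≤ 2 + (Q(0) + 2M) exp(t + M)` with `M = ∫₀ᵀ∫₀¹ u_{xx}²`; in particular `ρ`
is bounded below by a positive constant. -/
theorem density_uniform_positivity
    (T : ℝ) (hT : 0 < T)
    (ρ u : ℝ → ℝ → ℝ)
    (hρ : ContDiff ℝ (⊤ : ℕ∞) (fun p : ℝ × ℝ => ρ p.1 p.2))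
    (hu : ContDiff ℝ (⊤ : ℕ∞) (fun p : ℝ × ℝ => u p.1 p.2))
    (hρpos : ∀ x ∈ Icc (0:ℝ) 1, ∀ t ∈ Icc (0:ℝ) T, 0 < ρ x t)
    (hcont : ∀ x ∈ Ioo (0:ℝ) 1, ∀ t ∈ Ioo (0:ℝ) T,
      pdt ρ x t + pdx (fun y s => ρ y s * u y s) x t = 0)
    (hbdry : ∀ t, u 0 t = 0 ∧ u 1 t = 0)
    (hmass : (∫ x in (0:ℝ)..1, ρ x 0) = 1) :
    (∀ x ∈ Icc (0:ℝ) 1, ∀ t ∈ Icc (0:ℝ) T,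
      1 / ρ x t ≤
        2 + (Qfun ρ 0 + 2 * ∫ t in (0:ℝ)..T, ∫ x in (0:ℝ)..1, (pdx (pdx u) x t) ^ 2)
          * Real.exp (t + ∫ t in (0:ℝ)..T, ∫ x in (0:ℝ)..1, (pdx (pdx u) x t) ^ 2)) ∧
    ∃ c : ℝ, 0 < c ∧ ∀ x ∈ Icc (0:ℝ) 1, ∀ t ∈ Icc (0:ℝ) T, c ≤ ρ x t := by
  have R : Sm ρ := hρ
  have U : Sm u := hu
  have cR := R.cont
  have cU := U.cont
  have cRx := R.pdx.cont
  have cRt := R.pdt.cont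
  have cUx := U.pdx.cont
  have cRxx := R.pdx.pdx.cont
  have cRtx := R.pdt.pdx.cont
  have cRxt := R.pdx.pdt.cont
  have cUxx := U.pdx.pdx.cont
  have u01 : uIcc (0:ℝ) 1 = Icc 0 1 := uIcc_of_le zero_le_one
  -- continuity equation on the closed rectangle
  have D0 : ∀ x ∈ Ioo (0:ℝ) 1, ∀ t ∈ Ioo (0:ℝ) T,
      pdt ρ x t + (pdx ρ x t * u x t + ρ x t * pdx u x t) = 0 := by
    intro x hx t ht
    rw [← hcont x hx t ht]
    congr 1
    exact ((R.hx x t).mul (U.hx x t)).deriv.symm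
  have D1 : ∀ x ∈ Ioo (0:ℝ) 1, ∀ t ∈ Ioo (0:ℝ) T,
      pdt (pdx ρ) x t + (pdx (pdx ρ) x t * u x t + pdx ρ x t * pdx u x t +
        (pdx ρ x t * pdx u x t + ρ x t * pdx (pdx u) x t)) = 0 := by
    intro x hx t ht
    rw [R.comm]
    have h := (R.pdt.hx x t).add
      (((R.pdx.hx x t).mul (U.hx x t)).add ((R.hx x t).mul (U.pdx.hx x t)))
    refine h.unique ((hasDerivAt_const x (0:ℝ)).congr_of_eventuallyEq ?_)
    filter_upwards [isOpen_Ioo.mem_nhds hx] with y hy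
    exact D0 y hy t ht
  have E0 := zero_ext hT (f := fun x t => pdt ρ x t + (pdx ρ x t * u x t + ρ x t * pdx u x t))
    (by fun_prop) D0
  have E1 := zero_ext hT (f := fun x t => pdt (pdx ρ) x t + (pdx (pdx ρ) x t * u x t + pdx ρ x t * pdx u x t +
        (pdx ρ x t * pdx u x t + ρ x t * pdx (pdx u) x t))) (by fun_prop) D1
  -- slices
  have sl : ∀ {f : ℝ → ℝ → ℝ}, Continuous (fun p : ℝ × ℝ => f p.1 p.2) → ∀ t,
      Continuous (fun x => f x t) := fun hf t => hf.comp (f := fun x : ℝ => (x, t)) (by fun_prop)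
  -- mass
  have mass : ∀ t ∈ Icc (0:ℝ) T, (∫ x in (0:ℝ)..1, ρ x t) = 1 := by
    obtain ⟨G, hG, hGe, hI⟩ := leib hT (F := ρ) (Ft := pdt ρ) cR.continuousOn cRt.continuousOn
      (fun x _ t _ => R.ht x t)
    intro t ht
    rw [hI t ht, hmass]
    have : ∫ s in (0:ℝ)..t, G s = ∫ s in (0:ℝ)..t, (0:ℝ) := by
      apply integral_congr
      intro s hs
      rw [uIcc_of_le ht.1] at hs
      have hs' : s ∈ Icc 0 T := ⟨hs.1, hs.2.trans ht.2⟩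
      simp only
      rw [hGe s hs']
      have h1 : ∫ x in (0:ℝ)..1, pdt ρ x s
          = ∫ x in (0:ℝ)..1, -(pdx ρ x s * u x s + ρ x s * pdx u x s) := by
        apply integral_congr
        intro x hx
        rw [u01] at hx
        simp only
        linarith [E0 x hx s hs']
      have s1 := sl cR s
      have s2 := sl cU s
      have s3 := sl cRx s
      have s4 := sl cUx s
      rw [h1, integral_eq_sub_of_hasDerivAt (f := fun x => -(ρ x s * u x s))
        (fun x _ => ((R.hx x s).mul (U.hx x s)).neg)
        (Continuous.intervalIntegrable (by fun_prop) _ _)]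
      simp [hbdry s]
    rw [this]; simp
  -- derivative of 1/ρ
  have dv : ∀ x ∈ Icc (0:ℝ) 1, ∀ t ∈ Icc (0:ℝ) T,
      HasDerivAt (fun y => 1 / ρ y t) (-pdx ρ x t / (ρ x t)^2) x := by
    intro x hx t ht
    simpa only [one_div] using (R.hx x t).fun_inv (hρpos x hx t ht).ne'
  have ne : ∀ p ∈ (Icc (0:ℝ) 1 ×ˢ Icc (0:ℝ) T), ρ p.1 p.2 ≠ 0 := fun p hp =>
    (hρpos p.1 hp.1 p.2 hp.2).ne'
  have Qe : ∀ t ∈ Icc (0:ℝ) T, Qfun ρ t = ∫ x in (0:ℝ)..1, (pdx ρ x t)^2 / (ρ x t)^3 := by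
    intro t ht
    apply integral_congr
    intro x hx
    rw [u01] at hx
    have := (hρpos x hx t ht).ne'
    have h2 : pdx (fun y s => 1 / ρ y s) x t = -pdx ρ x t / (ρ x t)^2 := (dv x hx t ht).deriv
    simp only [h2]
    field_simp
  have Qe' : ∀ t ∈ Icc (0:ℝ) T, Qfun ρ t = ∫ x in (0:ℝ)..1, ρ x t * (-pdx ρ x t / (ρ x t)^2)^2 := by
    intro t ht
    apply integral_congr
    intro x hx
    rw [u01] at hx
    have h2 : pdx (fun y s => 1 / ρ y s) x t = -pdx ρ x t / (ρ x t)^2 := (dv x hx t ht).deriv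
    simp only [h2]
  have slo : ∀ {f : ℝ → ℝ → ℝ}, ContinuousOn (fun p : ℝ × ℝ => f p.1 p.2) (Icc (0:ℝ) 1 ×ˢ Icc (0:ℝ) T) →
      ∀ t ∈ Icc (0:ℝ) T, ContinuousOn (fun x => f x t) (Icc 0 1) :=
    fun hf t ht => hf.comp (f := fun x : ℝ => (x, t)) (by fun_prop) (fun x hx => ⟨hx, ht⟩)
  have cW : ContinuousOn (fun p : ℝ × ℝ => -pdx ρ p.1 p.2 / (ρ p.1 p.2)^2) (Icc (0:ℝ) 1 ×ˢ Icc (0:ℝ) T) :=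
    cRx.neg.continuousOn.div (cR.pow 2).continuousOn (fun p hp => pow_ne_zero _ (ne p hp))
  have vb : ∀ t ∈ Icc (0:ℝ) T, ∀ x ∈ Icc (0:ℝ) 1, 1 / ρ x t ≤ 2 + Qfun ρ t := by
    intro t ht
    rw [Qe' t ht]
    exact static (r := fun x => ρ x t) (v := fun x => 1 / ρ x t)
      (w := fun x => -pdx ρ x t / (ρ x t)^2) (sl cR t).continuousOn
      (slo (f := fun x t => -pdx ρ x t / (ρ x t)^2) cW t ht) (fun x hx => hρpos x hx t ht)
      (fun x hx => mul_one_div_cancel (hρpos x hx t ht).ne') (fun x hx => dv x hx t ht) (mass t ht)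
  -- evolution of Q
  obtain ⟨G, hG, hGe, hI⟩ := leib hT (F := fun x t => (pdx ρ x t)^2 / (ρ x t)^3)
    (Ft := fun x t => (2 * pdx ρ x t * pdt (pdx ρ) x t * (ρ x t)^3
      - (pdx ρ x t)^2 * (3 * (ρ x t)^2 * pdt ρ x t)) / ((ρ x t)^3)^2)
    ((cRx.pow 2).continuousOn.div (cR.pow 3).continuousOn (fun p hp => pow_ne_zero _ (ne p hp)))
    (ContinuousOn.div (Continuous.continuousOn (by fun_prop)) (Continuous.continuousOn (by fun_prop))
      (fun p hp => pow_ne_zero _ (pow_ne_zero _ (ne p hp))))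
    (by
      intro x hx t ht
      have := ((R.pdx.ht x t).fun_pow 2).fun_div ((R.ht x t).fun_pow 3) (pow_ne_zero 3 (hρpos x hx t ht).ne')
      simpa using this)
  have cm : Continuous fun t => ∫ x in (0:ℝ)..1, (pdx (pdx u) x t)^2 := by
    apply intervalIntegral.continuous_parametric_intervalIntegral_of_continuous'
      (f := fun t x => (pdx (pdx u) x t)^2)
    exact (cUxx.pow 2).comp (continuous_snd.prodMk continuous_fst)
  have hGW : ∀ t ∈ Icc (0:ℝ) T, G t = ∫ x in (0:ℝ)..1, 2 * (-pdx ρ x t / (ρ x t)^2) * pdx (pdx u) x t := by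
    intro t ht
    have s1 := sl cR t
    have s2 := sl cU t
    have s3 := sl cRx t
    have s4 := sl cUx t
    have s5 := sl cUxx t
    have s6 := sl cRxx t
    have sW := slo (f := fun x t => -pdx ρ x t / (ρ x t)^2) cW t ht
    have hBc : ContinuousOn (fun x => pdx u x t * ((pdx ρ x t)^2 / (ρ x t)^3) + u x t *
        ((2 * pdx ρ x t * pdx (pdx ρ) x t * (ρ x t)^3
      - (pdx ρ x t)^2 * (3 * (ρ x t)^2 * pdx ρ x t)) / ((ρ x t)^3)^2)) (Icc 0 1) := by
      refine ContinuousOn.add (s4.continuousOn.mul (ContinuousOn.div (Continuous.continuousOn (by fun_prop)) (Continuous.continuousOn (by fun_prop)) ?_)) (s2.continuousOn.mul (ContinuousOn.div (Continuous.continuousOn (by fun_prop)) (Continuous.continuousOn (by fun_prop)) ?_))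
      · exact fun x hx => pow_ne_zero _ (hρpos x hx t ht).ne'
      · exact fun x hx => pow_ne_zero _ (pow_ne_zero _ (hρpos x hx t ht).ne')
    have hB : ∫ x in (0:ℝ)..1, (pdx u x t * ((pdx ρ x t)^2 / (ρ x t)^3) + u x t *
        ((2 * pdx ρ x t * pdx (pdx ρ) x t * (ρ x t)^3
      - (pdx ρ x t)^2 * (3 * (ρ x t)^2 * pdx ρ x t)) / ((ρ x t)^3)^2)) = 0 := by
      rw [integral_eq_sub_of_hasDerivAt (f := fun x => u x t * ((pdx ρ x t)^2 / (ρ x t)^3)) _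
        (ContinuousOn.intervalIntegrable (u01 ▸ hBc))]
      · simp [hbdry t]
      · intro x hx
        rw [u01] at hx
        have := (U.hx x t).fun_mul (((R.pdx.hx x t).fun_pow 2).fun_div ((R.hx x t).fun_pow 3) (pow_ne_zero 3 (hρpos x hx t ht).ne'))
        simpa using this
    rw [hGe t ht]
    refine Eq.trans ?_ ((congrArg (fun z => (∫ x in (0:ℝ)..1, 2 * (-pdx ρ x t / (ρ x t)^2) * pdx (pdx u) x t) - z) hB).trans (sub_zero _))
    rw [← intervalIntegral.integral_sub]
    · apply integral_congr
      intro x hx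
      rw [u01] at hx
      have hp := (hρpos x hx t ht).ne'
      have e0 : pdt ρ x t = -(pdx ρ x t * u x t + ρ x t * pdx u x t) := by linarith [E0 x hx t ht]
      have e1 : pdt (pdx ρ) x t = -(pdx (pdx ρ) x t * u x t + pdx ρ x t * pdx u x t +
        (pdx ρ x t * pdx u x t + ρ x t * pdx (pdx u) x t)) := by linarith [E1 x hx t ht]
      simp only [e0, e1]
      field_simp
      ring
    · exact ContinuousOn.intervalIntegrable (u01 ▸ (continuousOn_const.mul sW).mul s5.continuousOn)
    · exact ContinuousOn.intervalIntegrable (u01 ▸ hBc)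
  have hGle : ∀ t ∈ Icc (0:ℝ) T, G t ≤ Qfun ρ t + (2 + Qfun ρ t) * ∫ x in (0:ℝ)..1, (pdx (pdx u) x t)^2 := by
    intro t ht
    have s5 := sl cUxx t
    have sW := slo (f := fun x t => -pdx ρ x t / (ρ x t)^2) cW t ht
    have i1 : IntervalIntegrable (fun x => ρ x t * (-pdx ρ x t / (ρ x t)^2)^2) MeasureTheory.volume 0 1 :=
      ContinuousOn.intervalIntegrable (u01 ▸ (sl cR t).continuousOn.mul (sW.pow 2))
    have i2 : IntervalIntegrable (fun x => (2 + Qfun ρ t) * (pdx (pdx u) x t)^2) MeasureTheory.volume 0 1 :=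
      Continuous.intervalIntegrable (by fun_prop) _ _
    calc G t ≤ ∫ x in (0:ℝ)..1, (ρ x t * (-pdx ρ x t / (ρ x t)^2)^2 + (2 + Qfun ρ t) * (pdx (pdx u) x t)^2) := by
          rw [hGW t ht]
          apply integral_mono_on zero_le_one _ (i1.add i2)
          · intro x hx
            have h1 := vb t ht x hx
            have hp := hρpos x hx t ht
            generalize -pdx ρ x t / (ρ x t)^2 = w
            generalize pdx (pdx u) x t = z
            have h2 : 1 / ρ x t * z^2 ≤ (2 + Qfun ρ t) * z^2 := by gcongr
            have h3 : 0 ≤ 1 / ρ x t * (ρ x t * w - z)^2 := by positivity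
            have h4 : 1 / ρ x t * (ρ x t * w - z)^2 = ρ x t * w^2 - 2 * w * z + 1 / ρ x t * z^2 := by
              field_simp
              ring
            linarith
          · exact ContinuousOn.intervalIntegrable (u01 ▸ (continuousOn_const.mul sW).mul s5.continuousOn)
      _ = _ := by
          rw [intervalIntegral.integral_add i1 i2, ← Qe' t ht, intervalIntegral.integral_const_mul]
  have h0 : (0:ℝ) ∈ Icc 0 T := ⟨le_rfl, hT.le⟩
  have gr := gron hT (Q := Qfun ρ) hG cm
    (fun t => integral_nonneg zero_le_one fun x _ => sq_nonneg _)
    (by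
      rw [Qe' 0 h0]
      exact integral_nonneg zero_le_one fun x hx => mul_nonneg (hρpos x hx 0 h0).le (sq_nonneg _))
    (fun t ht => by rw [Qe t ht, Qe 0 h0]; exact hI t ht) hGle
  refine ⟨fun x hx t ht => (vb t ht x hx).trans (by linarith [gr t ht]), ?_⟩
  obtain ⟨p, hp, hmin⟩ := (isCompact_Icc.prod isCompact_Icc).exists_isMinOn
    (s := Icc (0:ℝ) 1 ×ˢ Icc (0:ℝ) T) ⟨(0, 0), ⟨by simp, h0⟩⟩ cR.continuousOn
  exact ⟨ρ p.1 p.2, hρpos _ hp.1 _ hp.2, fun x hx t ht => hmin (show (x, t) ∈ _ from ⟨hx, ht⟩)⟩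

end
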